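/- Let p₁, …, p_ν ∈ ℂ (ν ≥ 1) be distinct points, set ρ(z) = min_{1≤i≤ν} |z − p_i|, and for i < j put E_{ij} = { z ∈ ℂ : |z − p_i| = |z − p_j| = ρ(z) }. Then for every smooth compactly supported function ψ : ℂ → ℝ, −(1/2π)·∫_ℂ log ρ(z) · Δψ(z) dλ(z) = Σ_{1 ≤ i < j ≤ ν} ∫_{E_{ij}} ψ(z)·|p_i − p_j| / (2π·|z − p_i|·|z − p_j|) dH¹(z) − Σ_{i=1}^ν ψ(p_i), where Δψ is the usual Laplacian of ψ (viewing ℂ = ℝ²), λ is the Lebesgue measure on ℂ, and H¹ is the one-dimensional Hausdorff measure. -/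

import Mathlib

open Complex Metric Filter Set Topology MeasureTheory

/-- The usual Laplacian `Δψ = ∂²ψ/∂x² + ∂²ψ/∂y²` of a function `ψ : ℂ → ℝ`,
viewing `ℂ = ℝ²` (directions `1` and `I`). -/
noncomputable def planarLaplacian (ψ : ℂ → ℝ) (z : ℂ) : ℝ :=
  fderiv ℝ (fun w : ℂ => fderiv ℝ ψ w 1) z 1 +
    fderiv ℝ (fun w : ℂ => fderiv ℝ ψ w Complex.I) z Complex.I

/-- The pairing `⟨∇ log |z - p|, ∇φ⟩`. -/
noncomputable def radialPairing (φ : ℂ → ℝ) (p z : ℂ) : ℝ :=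
  fderiv ℝ φ z (z - p) / ‖z - p‖ ^ 2

lemma locallyIntegrable_inv_norm_sub (p : ℂ) :
    LocallyIntegrable (fun z : ℂ => ‖z - p‖⁻¹) := by
  rw [locallyIntegrable_iff]
  intro K hK
  obtain ⟨R, hR⟩ := (hK.isBounded.subset_ball p)
  have h0 : Integrable (fun z : ℂ => (Iio R).indicator (fun r : ℝ => r⁻¹) ‖z‖) := by
    rw [integrable_fun_norm_addHaar volume, Complex.finrank_real_complex]
    refine IntegrableOn.of_forall_sdiff_eq_zero (s := Ioc 0 R) ?_ measurableSet_Ioi ?_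
    · refine Integrable.mono' (g := fun _ => (1 : ℝ)) (by simp) ?_ ?_
      · exact (Measurable.mul (by fun_prop)
          ((measurable_inv).indicator measurableSet_Iio)).aestronglyMeasurable
      · refine (ae_restrict_iff' measurableSet_Ioc).2 (ae_of_all _ fun r hr => ?_)
        by_cases h : r < R
        · simp [h, hr.1.ne']
        · simp [h]
    · rintro r ⟨h1, h2⟩
      have : ¬ r < R := fun h => h2 ⟨h1, h.le⟩
      simp [this]
  have h1 := h0.comp_sub_right p
  refine (h1.integrableOn (s := K)).congr_fun ?_ hK.measurableSet
  intro z hz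
  have : ‖z - p‖ < R := by simpa [dist_eq_norm] using hR hz
  simp [this]

lemma measurable_radialPairing {φ : ℂ → ℝ} (hφ : ContDiff ℝ 1 φ) (p : ℂ) :
    Measurable (radialPairing φ p) := by
  have h : Continuous fun z => fderiv ℝ φ z (z - p) :=
    (hφ.continuous_fderiv one_ne_zero).clm_apply (by fun_prop)
  unfold radialPairing
  exact h.measurable.div (by fun_prop)

lemma abs_radialPairing_le (φ : ℂ → ℝ) (p z : ℂ) :
    |radialPairing φ p z| ≤ ‖z - p‖⁻¹ * ‖fderiv ℝ φ z‖ := by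
  rcases eq_or_ne (z - p) 0 with h | h
  · simp [radialPairing, h]
  have h' : 0 < ‖z - p‖ := norm_pos_iff.2 h
  rw [radialPairing, abs_div, abs_of_nonneg (sq_nonneg ‖z - p‖), div_le_iff₀ (by positivity)]
  calc |fderiv ℝ φ z (z - p)| ≤ ‖fderiv ℝ φ z‖ * ‖z - p‖ := (fderiv ℝ φ z).le_opNorm _
    _ = ‖z - p‖⁻¹ * ‖fderiv ℝ φ z‖ * ‖z - p‖ ^ 2 := by field_simp

lemma integrable_radialPairing {φ : ℂ → ℝ} (hφ : ContDiff ℝ 1 φ) (hc : HasCompactSupport φ)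
    (p : ℂ) : Integrable (radialPairing φ p) := by
  have h := (locallyIntegrable_inv_norm_sub p).integrable_smul_right_of_hasCompactSupport
    (g := fun z => ‖fderiv ℝ φ z‖) (hφ.continuous_fderiv one_ne_zero).norm (hc.fderiv ℝ).norm
  exact h.mono' (measurable_radialPairing hφ p).aestronglyMeasurable
    (ae_of_all _ fun z => abs_radialPairing_le φ p z)

lemma integral_fderiv_ray {φ : ℂ → ℝ} (hφ : ContDiff ℝ 1 φ) (hc : HasCompactSupport φ)
    (p : ℂ) {e : ℂ} (he : e ≠ 0) (b : ℝ) :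
    ∫ r in Ioi b, fderiv ℝ φ (p + r * e) e = -φ (p + b * e) := by
  have hd : ∀ r : ℝ, HasDerivAt (fun r : ℝ => φ (p + r * e)) (fderiv ℝ φ (p + r * e) e) r := by
    intro r
    have h1 : HasDerivAt (fun r : ℝ => p + (r : ℂ) * e) e r := by
      simpa using ((Complex.ofRealCLM.hasDerivAt (x := r)).mul_const e).const_add p
    exact ((hφ.differentiable one_ne_zero _).hasFDerivAt).comp_hasDerivAt r h1
  have hsupp : HasCompactSupport (fun r : ℝ => φ (p + r * e)) := by
    obtain ⟨R, hR⟩ := hc.isCompact.isBounded.subset_closedBall p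
    refine HasCompactSupport.of_support_subset_isCompact
      (isCompact_Icc (a := -(R / ‖e‖)) (b := R / ‖e‖)) ?_
    intro r hr
    have := hR (subset_tsupport _ (by simpa using hr : (p + r * e) ∈ Function.support φ))
    rw [mem_closedBall, dist_eq_norm] at this
    rw [mem_Icc, ← abs_le, le_div_iff₀ (norm_pos_iff.2 he)]
    simpa using this
  have hs : ContDiff ℝ 1 (fun r : ℝ => φ (p + r * e)) :=
    hφ.comp (contDiff_const.add (Complex.ofRealCLM.contDiff.mul contDiff_const))
  rw [← hsupp.integral_Ioi_deriv_eq hs b]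
  simp_rw [fun r => (hd r).deriv]

lemma fderiv_eq_zero_of_bound {φ : ℂ → ℝ} (hc : HasCompactSupport φ) (p : ℂ) :
    ∃ R : ℝ, ∀ z, R < ‖z - p‖ → fderiv ℝ φ z = 0 := by
  obtain ⟨R, hR⟩ := (hc.fderiv ℝ).isCompact.isBounded.subset_closedBall p
  refine ⟨R, fun z hz => ?_⟩
  by_contra h
  have := hR (subset_tsupport _ h)
  rw [mem_closedBall, dist_eq_norm] at this
  linarith

lemma integral_radialPairing {φ : ℂ → ℝ} (hφ : ContDiff ℝ 1 φ) (hc : HasCompactSupport φ)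
    (p : ℂ) : ∫ z, radialPairing φ p z = -(2 * Real.pi * φ p) := by
  set e : ℝ → ℂ := fun θ => Real.cos θ + Real.sin θ * Complex.I with he
  have hen : ∀ θ, ‖e θ‖ = 1 := fun θ => by
    simp only [he, Complex.ofReal_cos, Complex.ofReal_sin]
    exact Complex.norm_cos_add_sin_mul_I θ
  have hec : Continuous e := by fun_prop
  set K : ℝ × ℝ → ℝ := fun q => fderiv ℝ φ (p + q.1 * e q.2) (e q.2) with hK
  have hKc : Continuous K := ((hφ.continuous_fderiv one_ne_zero).comp (by fun_prop)).clm_apply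
    (by fun_prop)
  obtain ⟨R, hR⟩ := fderiv_eq_zero_of_bound hc p
  have hφ_int : IntegrableOn K (Ioi 0 ×ˢ Ioo (-Real.pi) Real.pi) := by
    refine IntegrableOn.of_forall_sdiff_eq_zero
      (s := Icc 0 R ×ˢ Icc (-Real.pi) Real.pi) ?_ (measurableSet_Ioi.prod measurableSet_Ioo) ?_
    · exact hKc.continuousOn.integrableOn_compact (isCompact_Icc.prod isCompact_Icc)
    · rintro ⟨r, θ⟩ ⟨⟨h1, h2⟩, h3⟩
      simp only [mem_Ioi] at h1
      have hr : R < r := by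
        by_contra hr
        exact h3 ⟨⟨h1.le, not_lt.1 hr⟩, ⟨h2.1.le, h2.2.le⟩⟩
      simp [hK, hR (p + r * e θ) (by simpa [hen, abs_of_pos h1] using hr)]
  calc ∫ z, radialPairing φ p z = ∫ z, radialPairing φ p (z + p) :=
        (integral_add_right_eq_self _ p).symm
    _ = ∫ q in Ioi 0 ×ˢ Ioo (-Real.pi) Real.pi, K q := by
        rw [← Complex.integral_comp_polarCoord_symm, polarCoord_target]
        refine setIntegral_congr_fun (measurableSet_Ioi.prod measurableSet_Ioo) ?_
        rintro ⟨r, θ⟩ ⟨h1, -⟩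
        simp only [mem_Ioi] at h1
        have h2 : Complex.polarCoord.symm (r, θ) = r * e θ := Complex.polarCoord_symm_apply _
        simp only [h2, radialPairing, hK, add_sub_cancel_right, smul_eq_mul, norm_mul, hen,
          Complex.norm_real, Real.norm_eq_abs, mul_one, sq_abs]
        rw [show (r : ℂ) * e θ = r • e θ from rfl, map_smul, add_comm p, smul_eq_mul]
        field_simp
    _ = ∫ θ in Ioo (-Real.pi) Real.pi, ∫ r in Ioi 0, K (r, θ) := by
        rw [IntegrableOn, Measure.volume_eq_prod, ← Measure.prod_restrict] at hφ_int
        rw [Measure.volume_eq_prod, ← Measure.prod_restrict, integral_prod_symm _ hφ_int]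
    _ = ∫ θ in Ioo (-Real.pi) Real.pi, -φ p := by
        refine integral_congr_ae (ae_of_all _ fun θ => ?_)
        have : e θ ≠ 0 := fun h => by simpa [h] using hen θ
        simpa using integral_fderiv_ray hφ hc p this 0
    _ = _ := by
        rw [setIntegral_const, Real.volume_real_Ioo_of_le (by linarith [Real.pi_pos]), smul_eq_mul]
        ring

/-- Integration of the radial pairing over the part of a cone with apex `0` lying beyond the
line `re = 1 / 2`. -/
lemma setIntegral_radialPairing_cone {φ : ℂ → ℝ} (hφ : ContDiff ℝ 1 φ)
    (hc : HasCompactSupport φ) {S : Set ℝ} (hS : MeasurableSet S) :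
    ∫ w in {w : ℂ | 1 / 2 < w.re ∧ w.im / w.re ∈ S}, radialPairing φ 0 w =
      -∫ σ in S, (1 + σ ^ 2)⁻¹ * φ ((1 / 2 : ℝ) * (1 + σ * Complex.I)) := by
  set D := {w : ℂ | 1 / 2 < w.re ∧ w.im / w.re ∈ S} with hD
  have hDm : MeasurableSet D :=
    (measurableSet_lt measurable_const Complex.measurable_re).inter
      ((Complex.measurable_im.div Complex.measurable_re) hS)
  set e : ℝ → ℂ := fun σ => 1 + σ * Complex.I with he
  have hec : Continuous e := by fun_prop
  have he0 : ∀ σ, e σ ≠ 0 := fun σ h => by simpa [he] using congrArg Complex.re h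
  have hen : ∀ σ, ‖e σ‖ ^ 2 = 1 + σ ^ 2 := fun σ => by
    rw [Complex.sq_norm, Complex.normSq_apply]; simp [he]; ring
  set K : ℝ × ℝ → ℝ := fun q => (1 + q.2 ^ 2)⁻¹ * fderiv ℝ φ (0 + q.1 * e q.2) (e q.2) with hK
  have hKc : Continuous K := by
    refine Continuous.mul (Continuous.inv₀ (by fun_prop) fun q => by positivity) ?_
    exact ((hφ.continuous_fderiv one_ne_zero).comp (by fun_prop)).clm_apply (by fun_prop)
  obtain ⟨R, hR⟩ := fderiv_eq_zero_of_bound hc 0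
  have hφ_int : IntegrableOn K (Ioi (1 / 2) ×ˢ S) := by
    refine IntegrableOn.of_forall_sdiff_eq_zero
      (s := (Icc (1 / 2) R ×ˢ Icc (-(2 * R)) (2 * R))) ?_ (measurableSet_Ioi.prod hS) ?_
    · exact hKc.continuousOn.integrableOn_compact (isCompact_Icc.prod isCompact_Icc)
    · rintro ⟨r, σ⟩ ⟨⟨h1, h2⟩, h3⟩
      simp only [mem_Ioi] at h1
      have hr : R < ‖(r : ℂ) * e σ‖ := by
        by_contra! hr
        refine h3 ⟨⟨h1.le, ?_⟩, ?_⟩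
        · have := (Complex.re_le_norm ((r : ℂ) * e σ)).trans hr
          simpa [he] using this
        · have := (Complex.abs_im_le_norm ((r : ℂ) * e σ)).trans hr
          simp only [he, mul_add, mul_one, Complex.add_im, Complex.ofReal_im, zero_add,
            Complex.mul_im, Complex.ofReal_re, Complex.I_im, Complex.I_re, mul_zero, add_zero,
            Complex.mul_re, sub_zero, abs_mul, abs_of_pos (show 0 < r by linarith)]
            at this
          simp only [mem_Icc, ← abs_le]
          nlinarith [abs_nonneg σ]
      have h0 := hR (0 + r * e σ) (by simpa using hr)
      simp only [hK, h0, zero_apply, mul_zero]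
  have hI : Integrable (D.indicator (radialPairing φ 0)) :=
    (integrable_radialPairing hφ hc 0).indicator hDm
  have hmp := Complex.volume_preserving_equiv_real_prod.symm
  have hI2 : Integrable (fun q : ℝ × ℝ => D.indicator (radialPairing φ 0) ⟨q.1, q.2⟩) :=
    (hmp.integrable_comp_emb Complex.measurableEquivRealProd.symm.measurableEmbedding).2 hI
  have hinner : ∀ x : ℝ, ∫ y : ℝ, D.indicator (radialPairing φ 0) ⟨x, y⟩ =
      (Ioi (1 / 2)).indicator (fun x => ∫ σ in S, K (x, σ)) x := by
    intro x
    by_cases hx : 1 / 2 < x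
    · have hx0 : 0 < x := by linarith
      have h := Measure.integral_comp_mul_left
        (fun y : ℝ => D.indicator (radialPairing φ 0) ⟨x, y⟩) x
      rw [abs_of_pos (inv_pos.2 hx0), smul_eq_mul, eq_comm, inv_mul_eq_iff_eq_mul₀ hx0.ne'] at h
      rw [h, indicator_of_mem (by exact hx), ← integral_const_mul, ← integral_indicator hS]
      refine integral_congr_ae (ae_of_all _ fun σ => ?_)
      have hmem : (⟨x, x * σ⟩ : ℂ) ∈ D ↔ σ ∈ S := by
        simp [hD, hx0.ne', (by simpa using hx : (2:ℝ)⁻¹ < x)]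
      have heq : (⟨x, x * σ⟩ : ℂ) = x * e σ := by
        apply Complex.ext <;> simp [he]
      by_cases hσ : σ ∈ S
      · simp only [indicator_of_mem hσ, indicator_of_mem (hmem.2 hσ)]
        simp only [radialPairing, hK, heq, sub_zero, zero_add, norm_mul, mul_pow, hen,
          Complex.norm_real, Real.norm_eq_abs, sq_abs]
        nth_rewrite 2 [show (x : ℂ) * e σ = x • e σ from rfl]
        rw [map_smul, smul_eq_mul]
        field_simp
      · simp [indicator_of_notMem hσ, indicator_of_notMem (fun h => hσ (hmem.1 h))]
    · rw [indicator_of_notMem (by exact hx)]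
      have : ∀ y : ℝ, (⟨x, y⟩ : ℂ) ∉ D := fun y h => hx h.1
      simp [this]
  calc ∫ w in D, radialPairing φ 0 w = ∫ w, D.indicator (radialPairing φ 0) w :=
        (integral_indicator hDm).symm
    _ = ∫ q : ℝ × ℝ, D.indicator (radialPairing φ 0) ⟨q.1, q.2⟩ :=
        (hmp.integral_comp Complex.measurableEquivRealProd.symm.measurableEmbedding _).symm
    _ = ∫ x in Ioi (1 / 2), ∫ σ in S, K (x, σ) := by
        rw [Measure.volume_eq_prod] at hI2 ⊢
        rw [integral_prod _ hI2]
        simp_rw [hinner]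
        rw [integral_indicator measurableSet_Ioi]
    _ = ∫ σ in S, ∫ x in Ioi (1 / 2), K (x, σ) := by
        rw [IntegrableOn, Measure.volume_eq_prod, ← Measure.prod_restrict] at hφ_int
        exact integral_integral_swap hφ_int
    _ = _ := by
        rw [← integral_neg]
        refine integral_congr_ae (ae_of_all _ fun σ => ?_)
        simp only [hK, integral_const_mul]
        rw [integral_fderiv_ray hφ hc 0 (he0 σ)]
        simp [he]

lemma integral_comp_add_mul (F : ℂ → ℝ) (p : ℂ) {d : ℂ} (hd : d ≠ 0) :
    ∫ z, F z = ‖d‖ ^ 2 * ∫ w, F (p + d * w) := by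
  have hn : ‖d‖ ≠ 0 := norm_ne_zero_iff.2 hd
  have hu : ‖d / ‖d‖‖ = 1 := by simp [hn]
  set u : Circle := ⟨d / ‖d‖, by simpa [Submonoid.unitSphere] using hu⟩ with hu'
  have h1 := Measure.integral_comp_smul volume (fun w => F (p + (d / ‖d‖) * w)) ‖d‖
  have h2 : ∫ w, F (p + (d / ‖d‖) * w) = ∫ w, F (p + w) :=
    (rotation u).measurePreserving.integral_comp
      (rotation u).toHomeomorph.measurableEmbedding (fun w => F (p + w))
  have h3 : ∀ w : ℂ, (d / ‖d‖) * (‖d‖ • w) = d * w := fun w => by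
    have : (‖d‖ : ℂ) ≠ 0 := by exact_mod_cast hn
    rw [Complex.real_smul]
    field_simp
  simp_rw [h3] at h1
  rw [h1, h2, integral_add_left_eq_self, Complex.finrank_real_complex,
    abs_of_nonneg (by positivity), smul_eq_mul, mul_inv_cancel_left₀ (by positivity)]

lemma setIntegral_radialPairing_cone_affine {ψ : ℂ → ℝ} (hψ : ContDiff ℝ 1 ψ)
    (hc : HasCompactSupport ψ) (p : ℂ) {d : ℂ} (hd : d ≠ 0) {S : Set ℝ} (hS : MeasurableSet S) :
    ∫ z in {z : ℂ | 1 / 2 < ((z - p) / d).re ∧ ((z - p) / d).im / ((z - p) / d).re ∈ S},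
        radialPairing ψ p z =
      -∫ σ in S, (1 + σ ^ 2)⁻¹ * ψ (p + d * ((1 / 2 : ℝ) * (1 + σ * Complex.I))) := by
  have hφ : ContDiff ℝ 1 (fun w => ψ (p + d * w)) := hψ.comp (by fun_prop)
  have hφc : HasCompactSupport (fun w => ψ (p + d * w)) :=
    hc.comp_homeomorph ((Homeomorph.mulLeft₀ d hd).trans (Homeomorph.addLeft p))
  rw [← setIntegral_radialPairing_cone hφ hφc hS]
  have hm : Measurable fun z : ℂ => (z - p) / d := by fun_prop
  have hD : MeasurableSet {w : ℂ | 1 / 2 < w.re ∧ w.im / w.re ∈ S} :=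
    (measurableSet_lt measurable_const Complex.measurable_re).inter
      ((Complex.measurable_im.div Complex.measurable_re) hS)
  have hD' : MeasurableSet {z : ℂ | 1 / 2 < ((z - p) / d).re ∧
      ((z - p) / d).im / ((z - p) / d).re ∈ S} := hm hD
  rw [← integral_indicator hD', ← integral_indicator hD, integral_comp_add_mul _ p hd,
    ← integral_const_mul]
  refine integral_congr_ae (ae_of_all _ fun w => ?_)
  have hn : ‖d‖ ≠ 0 := norm_ne_zero_iff.2 hd
  have hfd : fderiv ℝ (fun w => ψ (p + d * w)) w w = fderiv ℝ ψ (p + d * w) (d * w) := by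
    have h1 : HasFDerivAt (fun w : ℂ => p + d * w) (d • ContinuousLinearMap.id ℝ ℂ) w :=
      ((hasFDerivAt_id w).const_mul d).const_add p
    have h2 := ((hψ.differentiable one_ne_zero (p + d * w)).hasFDerivAt).comp w h1
    have h3 := h2.fderiv
    simp only [Function.comp_def] at h3
    rw [h3]
    simp
  have hr : ‖d‖ ^ 2 * radialPairing ψ p (p + d * w) =
      radialPairing (fun w => ψ (p + d * w)) 0 w := by
    simp only [radialPairing, sub_zero, add_sub_cancel_left, hfd, norm_mul, mul_pow]
    field_simp
  classical
  simp only [indicator_apply, mem_ofPred_eq, add_sub_cancel_left, mul_div_cancel_left₀ _ hd]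
  split_ifs <;> simp [hr]

lemma setIntegral_hausdorff_bisector (F : ℂ → ℝ) (p : ℂ) {d : ℂ} (hd : d ≠ 0) {S : Set ℝ}
    (hS : MeasurableSet S) :
    ∫ z in {z : ℂ | ((z - p) / d).re = 1 / 2 ∧ 2 * ((z - p) / d).im ∈ S}, F z ∂μH[1] =
      ‖d‖ / 2 * ∫ σ in S, F (p + d * ((1 / 2 : ℝ) * (1 + σ * Complex.I))) := by
  have hn : ‖d‖ ≠ 0 := norm_ne_zero_iff.2 hd
  have hn' : (‖d‖ : ℂ) ≠ 0 := by exact_mod_cast hn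
  set f : ℝ → ℂ := fun s => p + d * (1 / 2 + (s / ‖d‖ : ℝ) * Complex.I) with hf
  have hiso : Isometry f := by
    refine Isometry.of_dist_eq fun x y => ?_
    rw [dist_eq_norm, Real.dist_eq, ← Real.norm_eq_abs, ← Complex.norm_real (x - y)]
    have : f x - f y = (d / ‖d‖) * Complex.I * ((x - y : ℝ) : ℂ) := by
      simp only [hf]; push_cast; field_simp; ring
    rw [this]; simp [hn]
  have hmapf := hiso.map_hausdorffMeasure (d := 1) (Or.inl zero_le_one)
  rw [hausdorffMeasure_real] at hmapf
  set E := {z : ℂ | ((z - p) / d).re = 1 / 2 ∧ 2 * ((z - p) / d).im ∈ S} with hE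
  have hm : Measurable fun z : ℂ => (z - p) / d := by fun_prop
  have hEm : MeasurableSet E :=
    (measurableSet_eq_fun (Complex.measurable_re.comp hm) measurable_const).inter
      (((Complex.measurable_im.comp hm).const_mul 2) hS)
  have hfv : ∀ s, (f s - p) / d = 1 / 2 + (s / ‖d‖ : ℝ) * Complex.I := fun s => by
    simp [hf, mul_div_cancel_left₀ _ hd]
  have hsub : E ⊆ range f := by
    rintro z ⟨h1, -⟩
    refine ⟨‖d‖ * ((z - p) / d).im, ?_⟩
    have : (z - p) / d = 1 / 2 + (((z - p) / d).im : ℂ) * Complex.I := by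
      apply Complex.ext <;> simp [h1]
    simp only [hf, mul_div_cancel_left₀ _ hn, ← this]
    field_simp
    ring
  have hpre : ∀ s, f s ∈ E ↔ 2 / ‖d‖ * s ∈ S := fun s => by
    simp only [hE, mem_ofPred_eq, hfv]
    have : 2 / ‖d‖ * s = 2 * (s / ‖d‖) := by ring
    simp [this]
  calc ∫ z in E, F z ∂μH[1] = ∫ z, E.indicator F z ∂(μH[1].restrict (range f)) := by
        rw [integral_indicator hEm, Measure.restrict_restrict hEm, inter_eq_left.2 hsub]
    _ = ∫ s, E.indicator F (f s) := by
        rw [← hmapf, hiso.isClosedEmbedding.measurableEmbedding.integral_map]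
    _ = ∫ s, (fun σ => S.indicator
          (fun σ : ℝ => F (p + d * ((1 / 2 : ℝ) * (1 + σ * Complex.I)))) σ) (2 / ‖d‖ * s) := by
        refine integral_congr_ae (ae_of_all _ fun s => ?_)
        by_cases h : f s ∈ E
        · have h' := (hpre s).1 h
          simp only [indicator_of_mem h, indicator_of_mem h']
          congr 1
          simp only [hf]
          push_cast
          field_simp
        · have h' := fun h'' => h ((hpre s).2 h'')
          simp only [indicator_of_notMem h, indicator_of_notMem h']
    _ = _ := by
        rw [Measure.integral_comp_mul_left, integral_indicator hS, abs_of_nonneg (by positivity),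
          inv_div, smul_eq_mul]

/-- Twice the coordinate of `z` along `q - p`, normalised so that `z` lies on the bisector of
`p` and `q` exactly when it equals `1`; it vanishes identically when `p = q`. -/
noncomputable def bisectorCoord (p q z : ℂ) : ℝ := 2 * ((z - p) / (q - p)).re

lemma continuous_bisectorCoord (p q : ℂ) : Continuous (bisectorCoord p q) := by
  unfold bisectorCoord
  exact continuous_const.mul (Complex.continuous_re.comp (by fun_prop))

lemma sq_dist_eq_add_bisectorCoord (p q z : ℂ) :
    dist z q ^ 2 = dist z p ^ 2 + (1 - bisectorCoord p q z) * dist p q ^ 2 := by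
  rcases eq_or_ne q p with rfl | h
  · simp
  have hd : q - p ≠ 0 := sub_ne_zero.2 h
  have hw : z - p = (q - p) * ((z - p) / (q - p)) := by field_simp
  set w := (z - p) / (q - p) with hw'
  have hq : z - q = (q - p) * (w - 1) := by rw [mul_sub, ← hw]; ring
  rw [dist_comm p q, dist_eq_norm, dist_eq_norm, dist_eq_norm, hq, hw, bisectorCoord, ← hw',
    norm_mul, norm_mul, mul_pow, mul_pow, Complex.sq_norm w, Complex.sq_norm (w - 1),
    Complex.normSq_apply, Complex.normSq_apply]
  simp
  ring

lemma dist_le_dist_iff_bisectorCoord {p q : ℂ} (z : ℂ) :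
    dist z p ≤ dist z q ↔ bisectorCoord p q z ≤ 1 := by
  rcases eq_or_ne q p with rfl | h
  · simp [bisectorCoord]
  have hpos : 0 < dist p q ^ 2 := by have := dist_pos.2 h.symm; positivity
  rw [← sq_le_sq₀ dist_nonneg dist_nonneg, sq_dist_eq_add_bisectorCoord p q z]
  constructor
  · intro h'
    by_contra! hlt
    nlinarith
  · intro h'
    nlinarith

lemma dist_eq_dist_iff_bisectorCoord {p q : ℂ} (h : p ≠ q) (z : ℂ) :
    dist z p = dist z q ↔ bisectorCoord p q z = 1 := by
  have hpos : dist p q ^ 2 ≠ 0 := by have := dist_pos.2 h; positivity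
  rw [← sq_eq_sq₀ dist_nonneg dist_nonneg, sq_dist_eq_add_bisectorCoord p q z]
  constructor
  · intro h'
    have : (1 - bisectorCoord p q z) * dist p q ^ 2 = 0 := by linarith
    have := (mul_eq_zero.1 this).resolve_right hpos
    linarith
  · intro h'
    rw [h']; ring

/-- The part of the plane hidden behind the Voronoi edge of `p i` and `p j` when seen
from `p i`. -/
def edgeShadow {ι : Type*} (p : ι → ℂ) (i j : ι) : Set ℂ :=
  {z | 1 < bisectorCoord (p i) (p j) z ∧
    ∀ k, bisectorCoord (p i) (p k) z ≤ bisectorCoord (p i) (p j) z}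

/-- The closed Voronoi edge of `p i` and `p j`. -/
def voronoiEdge {ι : Type*} (p : ι → ℂ) (i j : ι) : Set ℂ :=
  {z | dist z (p i) = dist z (p j) ∧ ∀ k, dist z (p i) ≤ dist z (p k)}

lemma measurableSet_edgeShadow {ι : Type*} [Countable ι] (p : ι → ℂ) (i j : ι) :
    MeasurableSet (edgeShadow p i j) := by
  have h : MeasurableSet
      {z | ∀ k, bisectorCoord (p i) (p k) z ≤ bisectorCoord (p i) (p j) z} := by
    simp only [ofPred_forall]
    exact MeasurableSet.iInter fun k => measurableSet_le
      (continuous_bisectorCoord _ _).measurable (continuous_bisectorCoord _ _).measurable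
  exact (measurableSet_lt measurable_const (continuous_bisectorCoord _ _).measurable).inter h

lemma setIntegral_radialPairing_edgeShadow {ι : Type*} [Countable ι] {p : ι → ℂ} {i j : ι}
    (hij : p i ≠ p j) {ψ : ℂ → ℝ} (hψ : ContDiff ℝ 1 ψ) (hc : HasCompactSupport ψ) :
    ∫ z in edgeShadow p i j, radialPairing ψ (p i) z =
      -∫ z in voronoiEdge p i j,
        ψ z * (dist (p i) (p j) / (2 * dist z (p i) * dist z (p j))) ∂μH[1] := by
  have hd : p j - p i ≠ 0 := sub_ne_zero.2 hij.symm
  set d := p j - p i with hd'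
  have hn : ‖d‖ ≠ 0 := norm_ne_zero_iff.2 hd
  set S : Set ℝ := {σ | ∀ k, ((1 + σ * Complex.I) * (d / (p k - p i))).re ≤ 1} with hS
  have hSm : MeasurableSet S := by
    simp only [hS, ofPred_forall]
    exact MeasurableSet.iInter fun k =>
      measurableSet_le (Complex.measurable_re.comp (by fun_prop)) measurable_const
  have hco : ∀ k z, bisectorCoord (p i) (p k) z =
      2 * ((z - p i) / d * (d / (p k - p i))).re := fun k z => by
    rw [bisectorCoord]; congr 2; field_simp
  have hcoj : ∀ z, bisectorCoord (p i) (p j) z = 2 * ((z - p i) / d).re := fun z => rfl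
  have hscale : ∀ (x y : ℝ) (c : ℂ), x ≠ 0 →
      ((⟨x, y⟩ : ℂ) * c).re = x * ((1 + (y / x : ℝ) * Complex.I) * c).re := fun x y c hx => by
    simp; field_simp
  have hshadow : edgeShadow p i j = {z : ℂ | 1 / 2 < ((z - p i) / d).re ∧
      ((z - p i) / d).im / ((z - p i) / d).re ∈ S} := by
    ext z
    simp only [edgeShadow, mem_ofPred_eq, hcoj, hS]
    have hlt : 1 < 2 * ((z - p i) / d).re ↔ 1 / 2 < ((z - p i) / d).re := by
      constructor <;> intro h <;> linarith
    rw [hlt]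
    refine and_congr_right fun h => forall_congr' fun k => ?_
    have hx : 0 < ((z - p i) / d).re := by linarith
    have := hscale ((z - p i) / d).re ((z - p i) / d).im (d / (p k - p i)) hx.ne'
    rw [hco, show (z - p i) / d * (d / (p k - p i)) =
      (⟨((z - p i) / d).re, ((z - p i) / d).im⟩ : ℂ) * (d / (p k - p i)) from rfl, this]
    constructor <;> intro h' <;> nlinarith
  have hedge : voronoiEdge p i j = {z : ℂ | ((z - p i) / d).re = 1 / 2 ∧
      2 * ((z - p i) / d).im ∈ S} := by
    ext z
    simp only [voronoiEdge, mem_ofPred_eq, dist_eq_dist_iff_bisectorCoord hij,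
      dist_le_dist_iff_bisectorCoord, hS]
    rw [hcoj]
    have heq : 2 * ((z - p i) / d).re = 1 ↔ ((z - p i) / d).re = 1 / 2 := by
      constructor <;> intro h <;> linarith
    rw [heq]
    refine and_congr_right fun h => forall_congr' fun k => ?_
    have := hscale ((z - p i) / d).re ((z - p i) / d).im (d / (p k - p i)) (by rw [h]; norm_num)
    rw [hco, show (z - p i) / d * (d / (p k - p i)) =
      (⟨((z - p i) / d).re, ((z - p i) / d).im⟩ : ℂ) * (d / (p k - p i)) from rfl, this, h,
      div_div_eq_mul_div, div_one, mul_comm _ (2 : ℝ), ← mul_assoc]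
    norm_num
  rw [hshadow, hedge, setIntegral_radialPairing_cone_affine hψ hc _ hd hSm,
    setIntegral_hausdorff_bisector _ _ hd hSm, ← integral_const_mul]
  congr 1
  refine integral_congr_ae (ae_of_all _ fun σ => ?_)
  set z : ℂ := p i + d * ((1 / 2 : ℝ) * (1 + σ * Complex.I)) with hz
  have hone : bisectorCoord (p i) (p j) z = 1 := by
    rw [hcoj, hz, add_sub_cancel_left, mul_div_cancel_left₀ _ hd]
    simp
  have hzi : dist z (p i) ^ 2 = ‖d‖ ^ 2 * (1 + σ ^ 2) / 4 := by
    rw [dist_eq_norm, hz, add_sub_cancel_left, norm_mul, norm_mul, mul_pow, mul_pow,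
      Complex.sq_norm (1 + σ * Complex.I), Complex.normSq_apply]
    simp
    ring
  have hzj := (dist_eq_dist_iff_bisectorCoord hij z).2 hone
  have hij' : dist (p i) (p j) = ‖d‖ := by rw [dist_comm, dist_eq_norm]
  simp only
  rw [← hzj, mul_assoc 2, ← sq, hzi, hij']
  have : 1 + σ ^ 2 ≠ 0 := by positivity
  field_simp
  ring

lemma ae_re_mul_ne {c : ℂ} (hc : c ≠ 0) (b : ℝ) : ∀ᵐ z : ℂ, (c * z).re ≠ b := by
  let L : ℂ →ₗ[ℝ] ℝ := Complex.reLm ∘ₗ LinearMap.mulLeft ℝ c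
  let s : AffineSubspace ℝ ℂ := (affineSpan ℝ {b}).comap L.toAffineMap
  have hmem : ∀ z, z ∈ s ↔ (c * z).re = b := fun z => by
    simp [s, L, AffineSubspace.mem_comap]
  have hs : s ≠ ⊤ := by
    intro h
    have : ((b + 1 : ℝ) : ℂ) / c ∈ s := by rw [h]; trivial
    rw [hmem, mul_div_cancel₀ _ hc, Complex.ofReal_re] at this
    linarith
  have h0 := Measure.addHaar_affineSubspace volume s hs
  rw [ae_iff]
  convert h0 using 2
  ext z
  simp [hmem]

lemma ae_bisectorCoord_ne {ι : Type*} [Countable ι] {p : ι → ℂ}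
    (hp : Function.Injective p) (i : ι) :
    ∀ᵐ z, ∀ j k, j ≠ k → bisectorCoord (p i) (p j) z ≠ bisectorCoord (p i) (p k) z := by
  simp only [ae_all_iff]
  intro j k hjk
  have hc : (p j - p i)⁻¹ - (p k - p i)⁻¹ ≠ 0 := by
    rw [sub_ne_zero, inv_injective.ne_iff]
    exact fun h => hjk (hp (sub_left_injective h))
  filter_upwards [ae_re_mul_ne hc (((p j - p i)⁻¹ - (p k - p i)⁻¹) * p i).re] with z hz h
  apply hz
  simp only [bisectorCoord, div_eq_mul_inv] at h
  have h' := mul_left_cancel₀ two_ne_zero h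
  rw [← sub_eq_zero, ← Complex.sub_re] at h' ⊢
  rw [← h']
  congr 1
  ring

lemma ae_dist_ne_dist {ι : Type*} [Countable ι] {p : ι → ℂ} (hp : Function.Injective p) :
    ∀ᵐ z, ∀ i j, i ≠ j → dist z (p i) ≠ dist z (p j) := by
  simp only [ae_all_iff]
  intro i j hij
  have hd : p j - p i ≠ 0 := sub_ne_zero.2 (hp.ne hij.symm)
  filter_upwards [ae_re_mul_ne (inv_ne_zero hd) (1 / 2 + ((p j - p i)⁻¹ * p i).re)] with z hz h
  rw [dist_eq_dist_iff_bisectorCoord (hp.ne hij), bisectorCoord, div_eq_inv_mul, mul_sub,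
    Complex.sub_re] at h
  apply hz
  linarith

/-- The closed Voronoi cell of `p i`. -/
def voronoiCell {ι : Type*} (p : ι → ℂ) (i : ι) : Set ℂ :=
  {z | ∀ k, dist z (p i) ≤ dist z (p k)}

lemma measurableSet_voronoiCell {ι : Type*} [Countable ι] (p : ι → ℂ) (i : ι) :
    MeasurableSet (voronoiCell p i) := by
  simp only [voronoiCell, ofPred_forall]
  exact MeasurableSet.iInter fun k => measurableSet_le (by fun_prop) (by fun_prop)

lemma mem_voronoiCell_iff {ι : Type*} {p : ι → ℂ} {i : ι} {z : ℂ} :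
    z ∈ voronoiCell p i ↔ ∀ k, bisectorCoord (p i) (p k) z ≤ 1 := by
  simp only [voronoiCell, mem_ofPred_eq, dist_le_dist_iff_bisectorCoord]

lemma indicator_voronoiCell_add_sum_edgeShadow {ι : Type*} [Fintype ι] {p : ι → ℂ} {i : ι} {z : ℂ}
    (hz : ∀ j k, j ≠ k → bisectorCoord (p i) (p j) z ≠ bisectorCoord (p i) (p k) z)
    (g : ℂ → ℝ) :
    (voronoiCell p i).indicator g z + ∑ j, (edgeShadow p i j).indicator g z = g z := by
  by_cases hV : z ∈ voronoiCell p i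
  · have : ∀ j, z ∉ edgeShadow p i j := fun j hj =>
      absurd hj.1 (not_lt.2 (mem_voronoiCell_iff.1 hV j))
    simp [hV, this]
  · obtain ⟨j, -, hj⟩ := Finset.exists_max_image Finset.univ
      (fun k => bisectorCoord (p i) (p k) z) ⟨i, Finset.mem_univ i⟩
    have hmem : z ∈ edgeShadow p i j := by
      refine ⟨?_, fun k => hj k (Finset.mem_univ k)⟩
      rw [mem_voronoiCell_iff] at hV
      push Not at hV
      obtain ⟨k, hk⟩ := hV
      exact hk.trans_le (hj k (Finset.mem_univ k))
    rw [indicator_of_notMem hV, zero_add, Finset.sum_eq_single j _ (by simp),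
      indicator_of_mem hmem]
    intro k _ hkj
    refine indicator_of_notMem (fun hk => ?_) _
    exact hz k j hkj (le_antisymm (hmem.2 k) (hk.2 j))

/-- The integral of `ψ` along the Voronoi edge of `p i` and `p j`, against the angular density
of the edge as seen from `p i`. -/
noncomputable def edgeIntegral {ι : Type*} (p : ι → ℂ) (ψ : ℂ → ℝ) (i j : ι) : ℝ :=
  ∫ z in voronoiEdge p i j, ψ z * (dist (p i) (p j) / (2 * dist z (p i) * dist z (p j))) ∂μH[1]

lemma edgeIntegral_comm {ι : Type*} (p : ι → ℂ) (ψ : ℂ → ℝ) (i j : ι) :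
    edgeIntegral p ψ i j = edgeIntegral p ψ j i := by
  have hE : voronoiEdge p i j = voronoiEdge p j i := by
    ext z
    simp only [voronoiEdge, mem_ofPred_eq]
    constructor
    · rintro ⟨h1, h2⟩
      exact ⟨h1.symm, fun k => h1 ▸ h2 k⟩
    · rintro ⟨h1, h2⟩
      exact ⟨h1.symm, fun k => h1 ▸ h2 k⟩
  unfold edgeIntegral
  rw [hE]
  congr 1 with z
  rw [dist_comm (p i)]
  ring

lemma edgeIntegral_self {ι : Type*} (p : ι → ℂ) (ψ : ℂ → ℝ) (i : ι) :
    edgeIntegral p ψ i i = 0 := by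
  simp [edgeIntegral]

lemma setIntegral_radialPairing_voronoiCell {ι : Type*} [Fintype ι] {p : ι → ℂ}
    (hp : Function.Injective p) {ψ : ℂ → ℝ} (hψ : ContDiff ℝ 1 ψ) (hc : HasCompactSupport ψ)
    (i : ι) :
    ∫ z in voronoiCell p i, radialPairing ψ (p i) z =
      -(2 * Real.pi * ψ (p i)) + ∑ j, edgeIntegral p ψ i j := by
  have hφ_int := integrable_radialPairing hψ hc (p i)
  have hsh : ∀ j, ∫ z, (edgeShadow p i j).indicator (radialPairing ψ (p i)) z =
      -edgeIntegral p ψ i j := by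
    intro j
    rw [integral_indicator (measurableSet_edgeShadow p i j)]
    rcases eq_or_ne i j with rfl | h
    · have : edgeShadow p i i = ∅ := by
        ext z
        simp only [edgeShadow, mem_ofPred_eq, mem_empty_iff_false, iff_false]
        rintro ⟨h1, -⟩
        simp [bisectorCoord] at h1
        linarith
      simp [this, edgeIntegral_self]
    · exact setIntegral_radialPairing_edgeShadow (hp.ne h) hψ hc
  have hsum : ∫ z, radialPairing ψ (p i) z =
      (∫ z in voronoiCell p i, radialPairing ψ (p i) z) + ∑ j, -edgeIntegral p ψ i j := by
    rw [← integral_indicator (measurableSet_voronoiCell p i)]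
    simp_rw [← hsh]
    rw [← integral_finsetSum _ fun j _ => hφ_int.indicator (measurableSet_edgeShadow p i j),
      ← integral_add (hφ_int.indicator (measurableSet_voronoiCell p i))
        (integrable_finsetSum _ fun j _ => hφ_int.indicator (measurableSet_edgeShadow p i j))]
    refine integral_congr_ae ?_
    filter_upwards [ae_bisectorCoord_ne hp i] with z hz
    exact (indicator_voronoiCell_add_sum_edgeShadow hz _).symm
  rw [integral_radialPairing hψ hc, Finset.sum_neg_distrib] at hsum
  linarith

lemma lineDeriv_log_dist {p z : ℂ} (h : z ≠ p) (v : ℂ) :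
    lineDeriv ℝ (fun w => Real.log (dist w p)) z v =
      ((z - p).re * v.re + (z - p).im * v.im) / ‖z - p‖ ^ 2 := by
  have hsq : ∀ w : ℂ, ‖w‖ ^ 2 = w.re ^ 2 + w.im ^ 2 := fun w => by
    rw [Complex.sq_norm, Complex.normSq_apply]; ring
  have h0 : ‖z - p‖ ^ 2 ≠ 0 := by
    have := norm_pos_iff.2 (sub_ne_zero.2 h)
    positivity
  have hf : ∀ t : ℝ, Real.log (dist (z + t • v) p) = 1 / 2 *
      Real.log (((z - p).re + t * v.re) ^ 2 + ((z - p).im + t * v.im) ^ 2) := by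
    intro t
    have : ((z - p).re + t * v.re) ^ 2 + ((z - p).im + t * v.im) ^ 2 =
        dist (z + t • v) p ^ 2 := by
      rw [dist_eq_norm, hsq]
      simp
      ring
    rw [this, Real.log_pow]
    push_cast
    ring
  have h1 : ∀ a b : ℝ, HasDerivAt (fun t : ℝ => (a + t * b) ^ 2) (2 * a * b) 0 := fun a b => by
    have := (((hasDerivAt_id (0 : ℝ)).mul_const b).const_add a).fun_pow 2
    simpa using this
  have h2 := (((h1 (z - p).re v.re).add (h1 (z - p).im v.im)).log
    (by simpa only [Pi.add_apply, zero_mul, add_zero, hsq] using h0)).const_mul (1 / 2)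
  rw [lineDeriv]
  simp_rw [hf]
  refine h2.deriv.trans ?_
  rw [hsq] at h0 ⊢
  simp only [Pi.add_apply, zero_mul, add_zero]
  field_simp

section TruncatedDistance

variable {ι : Type*} {p : ι → ℂ} {ρ : ℂ → ℝ}

lemma lipschitzWith_of_minDist (hle : ∀ z k, ρ z ≤ dist z (p k))
    (hex : ∀ z, ∃ k, ρ z = dist z (p k)) : LipschitzWith 1 ρ := by
  refine LipschitzWith.of_le_add fun z w => ?_
  obtain ⟨k, hk⟩ := hex w
  rw [hk, add_comm]
  exact (hle z k).trans (dist_triangle _ _ _)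

lemma lipschitzWith_log_max (hρ : LipschitzWith 1 ρ) {ε : ℝ} (hε : 0 < ε) :
    LipschitzWith (Real.toNNReal ε⁻¹) fun z => Real.log (max (ρ z) ε) := by
  refine LipschitzWith.of_le_add_mul _ fun z w => ?_
  rw [Real.coe_toNNReal _ (by positivity)]
  have hz : 0 < max (ρ z) ε := lt_max_of_lt_right hε
  have hw : 0 < max (ρ w) ε := lt_max_of_lt_right hε
  have h1 : max (ρ z) ε ≤ max (ρ w) ε + dist z w := by
    refine max_le ?_ (by linarith [le_max_right (ρ w) ε, dist_nonneg (x := z) (y := w)])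
    have := hρ.le_add_mul z w
    simp only [NNReal.coe_one, one_mul] at this
    linarith [le_max_left (ρ w) ε]
  have h2 := Real.log_le_sub_one_of_pos (div_pos hz hw)
  rw [Real.log_div hz.ne' hw.ne'] at h2
  have h3 : max (ρ z) ε / max (ρ w) ε - 1 ≤ ε⁻¹ * dist z w := by
    calc max (ρ z) ε / max (ρ w) ε - 1 = (max (ρ z) ε - max (ρ w) ε) / max (ρ w) ε := by
          field_simp
      _ ≤ dist z w / max (ρ w) ε := by gcongr; linarith
      _ ≤ dist z w / ε := by gcongr; exact le_max_right _ _
      _ = ε⁻¹ * dist z w := by ring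
  linarith

lemma sum_indicator_voronoiCell [Fintype ι] {i : ι} {z : ℂ}
    (hi : ∀ k, k ≠ i → dist z (p i) < dist z (p k))
    (g : ι → ℂ → ℝ) (ε : ℝ) :
    ∑ k, (voronoiCell p k ∩ {w | ε < dist w (p k)}).indicator (g k) z =
      {w | ε < dist w (p i)}.indicator (g i) z := by
  rw [Finset.sum_eq_single i _ (by simp)]
  · have : z ∈ voronoiCell p i := fun k => by
      rcases eq_or_ne k i with rfl | h
      · exact le_rfl
      · exact (hi k h).le
    rw [inter_comm, ← indicator_indicator]
    by_cases h : z ∈ {w | ε < dist w (p i)}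
    · simp only [indicator_of_mem h, indicator_of_mem this]
    · simp only [indicator_of_notMem h]
  · intro k _ hk
    exact indicator_of_notMem (fun h => absurd (h.1 i) (not_le.2 (hi k hk))) _

lemma lineDeriv_log_max [Finite ι] (hle : ∀ z k, ρ z ≤ dist z (p k))
    (hex : ∀ z, ∃ k, ρ z = dist z (p k))
    {ε : ℝ} (hε : 0 < ε) {i : ι} {z : ℂ} (hi : ∀ k, k ≠ i → dist z (p i) < dist z (p k))
    (hne : dist z (p i) ≠ ε) (v : ℂ) :
    lineDeriv ℝ (fun w => Real.log (max (ρ w) ε)) z v =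
      {w | ε < dist w (p i)}.indicator
        (fun w => ((w - p i).re * v.re + (w - p i).im * v.im) / ‖w - p i‖ ^ 2) z := by
  have hρ : ∀ᶠ w in 𝓝 z, ρ w = dist w (p i) := by
    have h : ∀ᶠ w in 𝓝 z, ∀ k, k ≠ i → dist w (p i) < dist w (p k) := by
      refine Filter.eventually_all.2 fun k => ?_
      by_cases hk : k = i
      · simp [hk]
      · filter_upwards [(isOpen_lt (f := fun w : ℂ => dist w (p i))
          (g := fun w : ℂ => dist w (p k)) (by fun_prop) (by fun_prop)).mem_nhds (hi k hk)]
          with w hw _ using hw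
    filter_upwards [h] with w hw
    obtain ⟨k, hk⟩ := hex w
    rcases eq_or_ne k i with rfl | hki
    · exact hk
    · exact absurd (hle w i) (not_le.2 (hk ▸ hw k hki))
  rcases lt_or_gt_of_ne hne with h | h
  · rw [indicator_of_notMem (by simpa using h.le)]
    have hev : (fun w => Real.log (max (ρ w) ε)) =ᶠ[𝓝 z] fun _ => Real.log ε := by
      filter_upwards [hρ, (isOpen_lt (f := fun w : ℂ => dist w (p i)) (g := fun _ => ε)
        (by fun_prop) (by fun_prop)).mem_nhds h] with w h1 h2
      rw [h1, max_eq_right (le_of_lt h2)]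
    rw [hev.lineDeriv_eq, lineDeriv, deriv_const]
  · rw [indicator_of_mem (by exact h)]
    have hev : (fun w => Real.log (max (ρ w) ε)) =ᶠ[𝓝 z] fun w => Real.log (dist w (p i)) := by
      filter_upwards [hρ, (isOpen_lt (f := fun _ => ε) (g := fun w : ℂ => dist w (p i))
        (by fun_prop) (by fun_prop)).mem_nhds h] with w h1 h2
      rw [h1, max_eq_left (le_of_lt h2)]
    rw [hev.lineDeriv_eq, lineDeriv_log_dist (dist_pos.1 (hε.trans h))]

lemma integral_log_max_mul_planarLaplacian [Fintype ι] (hp : Function.Injective p)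
    (hle : ∀ z k, ρ z ≤ dist z (p k)) (hex : ∀ z, ∃ k, ρ z = dist z (p k)) {ε : ℝ} (hε : 0 < ε)
    {ψ : ℂ → ℝ} (hψ : ContDiff ℝ (⊤ : ℕ∞) ψ) (hc : HasCompactSupport ψ) :
    ∫ z, Real.log (max (ρ z) ε) * planarLaplacian ψ z =
      -∫ z, ∑ i, (voronoiCell p i ∩ {w | ε < dist w (p i)}).indicator
        (radialPairing ψ (p i)) z := by
  have hu := lipschitzWith_log_max (lipschitzWith_of_minDist hle hex) hε
  set u : ℂ → ℝ := fun z => Real.log (max (ρ z) ε) with hu'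
  have hsm : ∀ v : ℂ, ContDiff ℝ (⊤ : ℕ∞) fun w => fderiv ℝ ψ w v := fun v =>
    (hψ.fderiv_right (by simp)).clm_apply contDiff_const
  have hcs : ∀ v : ℂ, HasCompactSupport fun w => fderiv ℝ ψ w v := fun v =>
    hc.fderiv_apply ℝ v
  have hparts : ∀ v : ℂ, ∫ z, u z * fderiv ℝ (fun w => fderiv ℝ ψ w v) z v =
      -∫ z, lineDeriv ℝ u z v * fderiv ℝ ψ z v := by
    intro v
    obtain ⟨C, hC⟩ := (hsm v).lipschitzWith_of_hasCompactSupport (hcs v) (by simp)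
    rw [hu.integral_lineDeriv_mul_eq hC (hcs v), ← integral_neg]
    refine integral_congr_ae (ae_of_all _ fun z => ?_)
    simp only [map_neg,
      ((hsm v).differentiable (by simp) z).lineDeriv_eq_fderiv]
    ring
  have hint1 : ∀ v : ℂ, Integrable fun z => u z * fderiv ℝ (fun w => fderiv ℝ ψ w v) z v := by
    intro v
    refine Continuous.integrable_of_hasCompactSupport
      (hu.continuous.mul (((hsm v).continuous_fderiv (by simp)).clm_apply continuous_const)) ?_
    exact ((hcs v).fderiv_apply ℝ v).mul_left
  have hint2 : ∀ v : ℂ, Integrable fun z => lineDeriv ℝ u z v * fderiv ℝ ψ z v := fun v =>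
    Integrable.bdd_mul ((hsm v).continuous.integrable_of_hasCompactSupport (hcs v))
      (measurable_lineDeriv hu.continuous).aestronglyMeasurable
      (ae_of_all _ fun z => norm_lineDeriv_le_of_lipschitz ℝ hu)
  simp only [planarLaplacian, mul_add]
  rw [integral_add (hint1 1) (hint1 I), hparts, hparts, ← neg_add,
    ← integral_add (hint2 1) (hint2 I)]
  congr 1
  refine integral_congr_ae ?_
  have hsphere : ∀ᵐ z : ℂ, ∀ i, dist z (p i) ≠ ε := by
    rw [ae_all_iff]
    intro i
    have h0 := Measure.addHaar_sphere (volume : Measure ℂ) (p i) ε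
    rw [ae_iff]
    convert h0 using 2
    ext z
    simp [dist_eq_norm]
  filter_upwards [ae_dist_ne_dist hp, hsphere] with z hz hzε
  obtain ⟨i, hi⟩ := hex z
  have hlt : ∀ k, k ≠ i → dist z (p i) < dist z (p k) := fun k hk =>
    lt_of_le_of_ne (hi ▸ hle z k) (hz i k hk.symm)
  rw [sum_indicator_voronoiCell hlt, lineDeriv_log_max hle hex hε hlt (hzε i),
    lineDeriv_log_max hle hex hε hlt (hzε i)]
  by_cases h : z ∈ {w | ε < dist w (p i)}
  · simp only [indicator_of_mem h, radialPairing]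
    have hlin : fderiv ℝ ψ z (z - p i) =
        (z - p i).re * fderiv ℝ ψ z 1 + (z - p i).im * fderiv ℝ ψ z I := by
      conv_lhs => rw [← Complex.re_add_im (z - p i)]
      rw [map_add, ← Complex.real_smul, ← smul_eq_mul, ← map_smul, ← smul_eq_mul, ← map_smul]
      simp
    rw [hlin]
    simp
    ring
  · simp [indicator_of_notMem h]

lemma abs_log_max_le {r ε : ℝ} (hr : 0 < r) (hε : 0 < ε) (hε1 : ε ≤ 1) :
    |Real.log (max r ε)| ≤ r + r⁻¹ := by
  have hm : 0 < max r ε := lt_max_of_lt_left hr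
  have h1 := Real.log_le_sub_one_of_pos hm
  have h2 : max r ε ≤ r + ε := max_le (by linarith) (by linarith)
  have h3 := Real.log_le_log hr (le_max_left r ε)
  have h4 := Real.log_le_sub_one_of_pos (inv_pos.2 hr)
  rw [Real.log_inv] at h4
  have h5 := inv_pos.2 hr
  rw [abs_le]
  constructor <;> linarith

lemma integral_log_mul_planarLaplacian [Fintype ι] (hp : Function.Injective p)
    (hle : ∀ z k, ρ z ≤ dist z (p k)) (hex : ∀ z, ∃ k, ρ z = dist z (p k))
    {ψ : ℂ → ℝ} (hψ : ContDiff ℝ (⊤ : ℕ∞) ψ) (hc : HasCompactSupport ψ) :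
    ∫ z, Real.log (ρ z) * planarLaplacian ψ z =
      -∑ i, ∫ z in voronoiCell p i, radialPairing ψ (p i) z := by
  have hψ1 : ContDiff ℝ 1 ψ := hψ.of_le (by exact_mod_cast le_top)
  have hρc : Continuous ρ := (lipschitzWith_of_minDist hle hex).continuous
  have hsm : ∀ v : ℂ, ContDiff ℝ (⊤ : ℕ∞) fun w => fderiv ℝ ψ w v := fun v =>
    (hψ.fderiv_right (by simp)).clm_apply contDiff_const
  have hΔc : Continuous (planarLaplacian ψ) :=
    (((hsm 1).continuous_fderiv (by simp)).clm_apply continuous_const).add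
      (((hsm I).continuous_fderiv (by simp)).clm_apply continuous_const)
  have hΔs : HasCompactSupport (planarLaplacian ψ) :=
    ((hc.fderiv_apply ℝ 1).fderiv_apply ℝ 1).add ((hc.fderiv_apply ℝ I).fderiv_apply ℝ I)
  have hφ_int : ∀ i, Integrable (radialPairing ψ (p i)) := fun i =>
    integrable_radialPairing hψ1 hc (p i)
  have hpos : ∀ᵐ z : ℂ, 0 < ρ z := by
    filter_upwards [(finite_range p).countable.ae_notMem volume] with z hz
    obtain ⟨k, hk⟩ := hex z
    rw [hk, dist_pos]
    rintro rfl
    exact hz ⟨k, rfl⟩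
  have hL : Tendsto (fun ε => ∫ z, Real.log (max (ρ z) ε) * planarLaplacian ψ z) (𝓝[>] 0)
      (𝓝 (∫ z, Real.log (ρ z) * planarLaplacian ψ z)) := by
    refine tendsto_integral_filter_of_dominated_convergence
      (fun z => (∑ i, (‖z - p i‖ + ‖z - p i‖⁻¹)) * |planarLaplacian ψ z|) ?_ ?_ ?_ ?_
    · exact Filter.Eventually.of_forall fun ε =>
        ((Real.measurable_log.comp (hρc.measurable.max measurable_const)).mul
          hΔc.measurable).aestronglyMeasurable
    · filter_upwards [Ioc_mem_nhdsGT (zero_lt_one' ℝ)] with ε hε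
      filter_upwards [hpos] with z hz
      rw [Real.norm_eq_abs, abs_mul]
      gcongr
      refine (abs_log_max_le hz hε.1 hε.2).trans ?_
      obtain ⟨k, hk⟩ := hex z
      rw [hk, dist_eq_norm]
      exact Finset.single_le_sum (f := fun i => ‖z - p i‖ + ‖z - p i‖⁻¹)
        (fun i _ => by positivity) (Finset.mem_univ k)
    · have hB : LocallyIntegrable (fun z : ℂ => ∑ i, (‖z - p i‖ + ‖z - p i‖⁻¹)) :=
        locallyIntegrable_finsetSum _ fun i _ =>
          (Continuous.locallyIntegrable (by fun_prop)).add (locallyIntegrable_inv_norm_sub _)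
      exact hB.integrable_smul_right_of_hasCompactSupport hΔc.abs hΔs.norm
    · filter_upwards [hpos] with z hz
      refine tendsto_const_nhds.congr' ?_
      filter_upwards [Ioo_mem_nhdsGT hz] with ε hε
      rw [max_eq_left hε.2.le]
  have hR : Tendsto (fun ε => ∫ z, ∑ i, (voronoiCell p i ∩ {w | ε < dist w (p i)}).indicator
        (radialPairing ψ (p i)) z) (𝓝[>] 0)
      (𝓝 (∫ z, ∑ i, (voronoiCell p i).indicator (radialPairing ψ (p i)) z)) := by
    refine tendsto_integral_filter_of_dominated_convergence
      (fun z => ∑ i, |radialPairing ψ (p i) z|) ?_ ?_ ?_ ?_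
    · refine Filter.Eventually.of_forall fun ε => ?_
      refine (Finset.measurable_sum _ fun i _ => ?_).aestronglyMeasurable
      exact (measurable_radialPairing hψ1 _).indicator
        ((measurableSet_voronoiCell p i).inter (measurableSet_lt (by fun_prop) (by fun_prop)))
    · refine Filter.Eventually.of_forall fun ε => ae_of_all _ fun z => ?_
      refine (norm_sum_le _ _).trans (Finset.sum_le_sum fun i _ => ?_)
      exact norm_indicator_le_norm_self _ _
    · exact integrable_finsetSum _ fun i _ => (hφ_int i).abs
    · refine ae_of_all _ fun z => tendsto_finsetSum _ fun i _ => ?_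
      rcases eq_or_ne z (p i) with rfl | h
      · have h0 : radialPairing ψ (p i) (p i) = 0 := by simp [radialPairing]
        simp [indicator_apply_eq_zero.2 fun _ => h0]
      · refine tendsto_const_nhds.congr' ?_
        filter_upwards [Ioo_mem_nhdsGT (dist_pos.2 h)] with ε hε
        rw [inter_comm, ← indicator_indicator,
          indicator_of_mem (s := {w | ε < dist w (p i)}) (by exact hε.2)]
  have hev : (fun ε => ∫ z, Real.log (max (ρ z) ε) * planarLaplacian ψ z) =ᶠ[𝓝[>] 0]
      fun ε => -∫ z, ∑ i, (voronoiCell p i ∩ {w | ε < dist w (p i)}).indicator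
        (radialPairing ψ (p i)) z := by
    filter_upwards [self_mem_nhdsWithin] with ε hε
    exact integral_log_max_mul_planarLaplacian hp hle hex hε hψ hc
  rw [tendsto_nhds_unique (hL.congr' hev) hR.neg,
    integral_finsetSum _ fun i _ => (hφ_int i).indicator (measurableSet_voronoiCell p i)]
  simp_rw [integral_indicator (measurableSet_voronoiCell p _)]

end TruncatedDistance

lemma sum_sum_eq_two_mul_sum_sum_lt {ι : Type*} [Fintype ι] [LinearOrder ι] (T : ι → ι → ℝ)
    (hsymm : ∀ i j, T i j = T j i) (hdiag : ∀ i, T i i = 0) :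
    ∑ i, ∑ j, T i j = 2 * ∑ i, ∑ j, if i < j then T i j else 0 := by
  have hsplit : ∀ i j, T i j = (if i < j then T i j else 0) + if j < i then T j i else 0 := by
    intro i j
    rcases lt_trichotomy i j with h | rfl | h
    · simp [h, h.not_gt]
    · simp [hdiag]
    · simp [h, h.not_gt, hsymm i j]
  have hcomm : ∑ i, ∑ j, (if j < i then T j i else 0) = ∑ i, ∑ j, if i < j then T i j else 0 :=
    Finset.sum_comm
  calc ∑ i, ∑ j, T i j
      = ∑ i, ∑ j, ((if i < j then T i j else 0) + if j < i then T j i else 0) :=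
        Finset.sum_congr rfl fun i _ => Finset.sum_congr rfl fun j _ => hsplit i j
    _ = _ := by simp only [Finset.sum_add_distrib, hcomm, two_mul]

/-- **Distributional Laplacian of `log(1/ρ)` (inside Lemma 5.11).** For distinct
points `p 0, …, p (ν-1)` with `ρ(z) = min_i |z − p i|` and Voronoi edges
`E i j = {z : |z − p i| = |z − p j| = ρ(z)}`, for every smooth compactly supported
`ψ : ℂ → ℝ`,
`−(1/2π)·∫ log ρ(z)·Δψ(z) dλ = Σ_{i<j} ∫_{E i j} ψ(z)·|p i − p j|/(2π|z − p i||z − p j|) dH¹ − Σ_i ψ(p i)`. -/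
theorem laplacian_log_inv_rho
    (ν : ℕ) (hν : 0 < ν) (p : Fin ν → ℂ) (hp : Function.Injective p)
    (ρfun : ℂ → ℝ)
    (hρfun : ∀ z : ℂ, ρfun z = Finset.univ.inf'
        (Finset.univ_nonempty_iff.mpr ⟨⟨0, hν⟩⟩) (fun i : Fin ν => dist z (p i)))
    (ψ : ℂ → ℝ) (hψ : ContDiff ℝ (⊤ : ℕ∞) ψ) (hψc : HasCompactSupport ψ) :
    -(1 / (2 * Real.pi)) * ∫ z : ℂ, Real.log (ρfun z) * planarLaplacian ψ z
      =
    (∑ i : Fin ν, ∑ j : Fin ν, if i < j then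
        ∫ z in {z : ℂ | dist z (p i) = dist z (p j) ∧ dist z (p i) = ρfun z},
          ψ z * (dist (p i) (p j) / (2 * Real.pi * dist z (p i) * dist z (p j))) ∂ μH[1]
      else 0)
    - ∑ i : Fin ν, ψ (p i) := by
  have hne : (Finset.univ : Finset (Fin ν)).Nonempty :=
    Finset.univ_nonempty_iff.mpr ⟨⟨0, hν⟩⟩
  have hle : ∀ z k, ρfun z ≤ dist z (p k) := fun z k => by
    rw [hρfun]
    exact Finset.inf'_le _ (Finset.mem_univ k)
  have hex : ∀ z, ∃ k, ρfun z = dist z (p k) := fun z => by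
    obtain ⟨k, -, hk⟩ := Finset.exists_mem_eq_inf' hne (fun i : Fin ν => dist z (p i))
    exact ⟨k, by rw [hρfun, hk]⟩
  have hψ1 : ContDiff ℝ 1 ψ := hψ.of_le (by exact_mod_cast le_top)
  have hedge : ∀ i j, {z : ℂ | dist z (p i) = dist z (p j) ∧ dist z (p i) = ρfun z} =
      voronoiEdge p i j := by
    intro i j
    ext z
    refine and_congr_right fun _ => ⟨fun h k => h ▸ hle z k, fun h => ?_⟩
    obtain ⟨k, hk⟩ := hex z
    exact le_antisymm (hk ▸ h k) (hle z i)
  have hterm : ∀ i j, ∫ z in {z : ℂ | dist z (p i) = dist z (p j) ∧ dist z (p i) = ρfun z},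
      ψ z * (dist (p i) (p j) / (2 * Real.pi * dist z (p i) * dist z (p j))) ∂ μH[1] =
      Real.pi⁻¹ * edgeIntegral p ψ i j := by
    intro i j
    rw [hedge, edgeIntegral, ← integral_const_mul]
    congr 1 with z
    simp only [div_eq_mul_inv, mul_inv]
    ring
  have hright : ∑ i : Fin ν, ∑ j : Fin ν, (if i < j then
        ∫ z in {z : ℂ | dist z (p i) = dist z (p j) ∧ dist z (p i) = ρfun z},
          ψ z * (dist (p i) (p j) / (2 * Real.pi * dist z (p i) * dist z (p j))) ∂ μH[1]
      else 0) = Real.pi⁻¹ * ∑ i, ∑ j, if i < j then edgeIntegral p ψ i j else 0 := by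
    simp only [hterm, Finset.mul_sum, mul_ite, mul_zero]
  rw [hright, integral_log_mul_planarLaplacian hp hle hex hψ hψc]
  simp_rw [setIntegral_radialPairing_voronoiCell hp hψ1 hψc]
  rw [Finset.sum_add_distrib, Finset.sum_neg_distrib, ← Finset.mul_sum,
    sum_sum_eq_two_mul_sum_sum_lt _ (edgeIntegral_comm p ψ) (edgeIntegral_self p ψ)]
  have := Real.pi_ne_zero
  field_simp
  ring
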